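/- arXiv:1712.06229 — 2 statements merged into one kernel-verified Lean document; each statement's English description precedes it below -/
import Mathlib

section
/- Let M ∈ {0,1}^{a×b} be a binary mask, let μ > 0 and λ₁ > 0, and let Y, L, E, S, X, Z ∈ ℝ^{a×b} with P_{M⊥}(X) = 0. Then the function G ↦ λ₁‖G‖₁ + (μ/2)‖P_M(Y − L − G)‖_F² + ⟨X, P_M(Y − L − G)⟩ + (μ/2)‖G − E − S‖_F² + ⟨Z, G − E − S⟩ has a unique global minimizer Ĝ ∈ ℝ^{a×b}, characterized by: P_M(Ĝ) = P_M( soft_{λ₁/(2μ)}( ½(Y − L + E + S) + (1/(2μ))(X − Z) ) ) and P_{M⊥}(Ĝ) = P_{M⊥}( soft_{λ₁/μ}( E + S − (1/μ) Z ) ), where the soft-thresholding is applied entrywise. -/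
/-- Entrywise soft-thresholding with threshold `t`. -/
noncomputable def softThreshold (t c : ℝ) : ℝ :=
  Real.sign c * max (|c| - t) 0

/-- Quadratic growth of `g ↦ t |g| + (g - c)² / 2` around its minimizer `softThreshold t c`. -/
theorem softThreshold_quadratic_growth {t : ℝ} (ht : 0 ≤ t) (c g : ℝ) :
    t * |softThreshold t c| + (softThreshold t c - c) ^ 2 / 2 + (g - softThreshold t c) ^ 2 / 2
      ≤ t * |g| + (g - c) ^ 2 / 2 := by
  unfold softThreshold
  have hg := mul_nonneg ht (sub_nonneg.2 (le_abs_self g))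
  have hg' := mul_nonneg ht (sub_nonneg.2 (neg_abs_le g))
  rcases le_or_gt |c| t with h | h
  · rw [max_eq_right (by linarith), mul_zero, abs_zero]
    have h1 : c * g ≤ t * |g| := by
      calc c * g ≤ |c * g| := le_abs_self _
        _ = |c| * |g| := abs_mul c g
        _ ≤ t * |g| := mul_le_mul_of_nonneg_right h (abs_nonneg g)
    nlinarith
  · rw [max_eq_left (by linarith)]
    rcases lt_trichotomy c 0 with hc | rfl | hc
    · rw [abs_of_neg hc] at h ⊢
      rw [Real.sign_of_neg hc, abs_of_neg (by linarith)]
      nlinarith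
    · rw [abs_zero] at h
      linarith
    · rw [abs_of_pos hc] at h ⊢
      rw [Real.sign_of_pos hc, one_mul, abs_of_pos (by linarith)]
      nlinarith

/-- Quadratic growth of a sum of an entrywise objective yields a unique global minimizer. -/
theorem unique_minimizer_of_entrywise_quadratic_growth {m n : Type*} [Fintype m] [Fintype n]
    {κ : ℝ} (hκ : 0 < κ) (h : m → n → ℝ → ℝ) (Ghat : Matrix m n ℝ)
    (hh : ∀ i j g, h i j (Ghat i j) + κ * (g - Ghat i j) ^ 2 ≤ h i j g) :
    (∀ G : Matrix m n ℝ, ∑ i, ∑ j, h i j (Ghat i j) ≤ ∑ i, ∑ j, h i j (G i j)) ∧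
      ∀ G : Matrix m n ℝ, ∑ i, ∑ j, h i j (G i j) ≤ ∑ i, ∑ j, h i j (Ghat i j) → G = Ghat := by
  have hle : ∀ i j g, h i j (Ghat i j) ≤ h i j g := fun i j g => by
    nlinarith [hh i j g, mul_nonneg hκ.le (sq_nonneg (g - Ghat i j))]
  have hrow : ∀ (G : Matrix m n ℝ) (i : m), ∑ j, h i j (Ghat i j) ≤ ∑ j, h i j (G i j) :=
    fun G i => Finset.sum_le_sum fun j _ => hle i j _
  refine ⟨fun G => Finset.sum_le_sum fun i _ => hrow G i, fun G hG => ?_⟩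
  ext i j
  have hsum := le_antisymm (Finset.sum_le_sum fun i _ => hrow G i) hG
  have hi := (Finset.sum_eq_sum_iff_of_le fun i _ => hrow G i).1 hsum i (Finset.mem_univ i)
  have hij := (Finset.sum_eq_sum_iff_of_le fun j _ => hle i j _).1 hi j (Finset.mem_univ j)
  have hsq : (G i j - Ghat i j) ^ 2 ≤ 0 := by
    have := hh i j (G i j)
    by_contra! hpos
    nlinarith [mul_pos hκ hpos]
  exact sub_eq_zero.1 (pow_eq_zero_iff two_ne_zero |>.1 (le_antisymm hsq (sq_nonneg _)))

/-- The G-subproblem of the missing-data TVRPCA augmented Lagrangian has a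
unique global minimizer `Ĝ`, characterized on observed entries (`M_{ij} = 1`) by
soft-thresholding with threshold `λ₁/(2μ)` of `½(Y − L + E + S) + (1/(2μ))(X − Z)` and on
unobserved entries (`M_{ij} = 0`) by soft-thresholding with threshold `λ₁/μ` of
`E + S − (1/μ)Z`. -/
theorem tvrpca_missing_data_G_subproblem
    (a b : ℕ) (M : Matrix (Fin a) (Fin b) ℝ) (hM : ∀ i j, M i j = 0 ∨ M i j = 1)
    (μ lam1 : ℝ) (hμ : 0 < μ) (hlam1 : 0 < lam1)
    (Y L E S X Z : Matrix (Fin a) (Fin b) ℝ)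
    (hX : ∀ i j, M i j = 0 → X i j = 0)
    (f : Matrix (Fin a) (Fin b) ℝ → ℝ)
    (hf : ∀ G, f G =
      lam1 * (∑ i, ∑ j, |G i j|)
      + (μ / 2) * (∑ i, ∑ j, (M i j * (Y i j - L i j - G i j)) ^ 2)
      + (∑ i, ∑ j, X i j * (M i j * (Y i j - L i j - G i j)))
      + (μ / 2) * (∑ i, ∑ j, (G i j - E i j - S i j) ^ 2)
      + (∑ i, ∑ j, Z i j * (G i j - E i j - S i j))) :
    ∃ Ghat : Matrix (Fin a) (Fin b) ℝ,
      (∀ G, f Ghat ≤ f G) ∧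
      (∀ G, (∀ G', f G ≤ f G') → G = Ghat) ∧
      (∀ i j, M i j * Ghat i j =
        M i j * (Real.sign ((Y i j - L i j + E i j + S i j) / 2 + (X i j - Z i j) / (2 * μ))
          * max (|(Y i j - L i j + E i j + S i j) / 2 + (X i j - Z i j) / (2 * μ)|
              - lam1 / (2 * μ)) 0)) ∧
      (∀ i j, (1 - M i j) * Ghat i j =
        (1 - M i j) * (Real.sign (E i j + S i j - Z i j / μ)
          * max (|E i j + S i j - Z i j / μ| - lam1 / μ) 0)) := by
  set c₁ : Fin a → Fin b → ℝ := fun i j =>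
    (Y i j - L i j + E i j + S i j) / 2 + (X i j - Z i j) / (2 * μ) with hc₁
  set c₀ : Fin a → Fin b → ℝ := fun i j => E i j + S i j - Z i j / μ with hc₀
  let h : Fin a → Fin b → ℝ → ℝ := fun i j g =>
    lam1 * |g| + μ / 2 * (M i j * (Y i j - L i j - g)) ^ 2
      + X i j * (M i j * (Y i j - L i j - g))
      + μ / 2 * (g - E i j - S i j) ^ 2 + Z i j * (g - E i j - S i j)
  let Ghat : Matrix (Fin a) (Fin b) ℝ := fun i j =>
    if M i j = 1 then softThreshold (lam1 / (2 * μ)) (c₁ i j)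
    else softThreshold (lam1 / μ) (c₀ i j)
  have hfh : ∀ G, f G = ∑ i, ∑ j, h i j (G i j) := fun G => by
    simp only [hf, h, Finset.mul_sum, Finset.sum_add_distrib]
  have hgrowth : ∀ i j g, h i j (Ghat i j) + μ / 2 * (g - Ghat i j) ^ 2 ≤ h i j g := by
    intro i j g
    rcases hM i j with h0 | h1
    · have hG : Ghat i j = softThreshold (lam1 / μ) (c₀ i j) := by simp [Ghat, h0]
      have key := mul_le_mul_of_nonneg_left
        (softThreshold_quadratic_growth (div_pos hlam1 hμ).le (c₀ i j) g) hμ.le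
      have expand : ∀ u, h i j u = μ * (lam1 / μ * |u| + (u - c₀ i j) ^ 2 / 2)
          - Z i j ^ 2 / (2 * μ) := fun u => by
        simp only [h, h0, hc₀]
        field_simp
        ring
      rw [expand, expand, hG]
      linarith
    · have hG : Ghat i j = softThreshold (lam1 / (2 * μ)) (c₁ i j) := by simp [Ghat, h1]
      have h2μ : 0 < 2 * μ := by linarith
      have key := mul_le_mul_of_nonneg_left
        (softThreshold_quadratic_growth (div_pos hlam1 h2μ).le (c₁ i j) g) h2μ.le
      have expand : ∀ u, h i j u = 2 * μ * (lam1 / (2 * μ) * |u| + (u - c₁ i j) ^ 2 / 2)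
          + (h i j 0 - μ * c₁ i j ^ 2) := fun u => by
        simp only [h, h1, hc₁, abs_zero]
        field_simp
        ring
      rw [expand, expand g, hG]
      nlinarith [mul_nonneg hμ.le (sq_nonneg (g - softThreshold (lam1 / (2 * μ)) (c₁ i j)))]
  obtain ⟨hmin, huniq⟩ :=
    unique_minimizer_of_entrywise_quadratic_growth (half_pos hμ) h Ghat hgrowth
  refine ⟨Ghat, fun G => ?_, fun G hG => huniq G ?_, fun i j => ?_, fun i j => ?_⟩
  · simpa only [hfh] using hmin G
  · simpa only [hfh] using hG Ghat
  · rcases hM i j with h0 | h1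
    · simp [h0]
    · simp [Ghat, h1, softThreshold, hc₁]
  · rcases hM i j with h0 | h1
    · simp [Ghat, h0, softThreshold, hc₀]
    · simp [h1]
end

section
/- Let r < q be nonnegative integers, let t_{r+1}, …, t_q be nonnegative real numbers, let c ∈ (0,1], and let z > max_i t_i with z > 0. Define φ(z) = (1/(q−r)) Σ_{i=r+1}^q z/(z² − t_i²) and the D-transform D(z) = φ(z)·( c φ(z) + (1−c)/z ), with derivative D′(z). Then D(z) > 0, D′(z) < 0, and the OptShrink shrinkage value −2 D(z)/D′(z) satisfies 0 < −2 D(z)/D′(z) ≤ z; i.e., the data-driven shrinkage applied by OptShrink maps each singular value lying strictly above the noise singular values to a positive value no larger than itself. -/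
theorem hasDerivAt_div_sq_sub_sq {a z : ℝ} (h : z ^ 2 - a ^ 2 ≠ 0) :
    HasDerivAt (fun s : ℝ => s / (s ^ 2 - a ^ 2))
      (-(z ^ 2 + a ^ 2) / (z ^ 2 - a ^ 2) ^ 2) z := by
  have hden : HasDerivAt (fun s : ℝ => s ^ 2 - a ^ 2) (2 * z) z := by
    simpa using (hasDerivAt_pow 2 z).sub_const (a ^ 2)
  refine ((hasDerivAt_id' z).fun_div hden h).congr_deriv ?_
  ring

theorem neg_sq_add_sq_div_le {a z : ℝ} (hz : 0 < z) (h : 0 < z ^ 2 - a ^ 2) :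
    -(z ^ 2 + a ^ 2) / (z ^ 2 - a ^ 2) ^ 2 ≤ -(z / (z ^ 2 - a ^ 2)) / z := by
  have e : -(z / (z ^ 2 - a ^ 2)) / z = -(z ^ 2 - a ^ 2) / (z ^ 2 - a ^ 2) ^ 2 := by
    field_simp
  rw [e]
  gcongr
  nlinarith [sq_nonneg a]

/-- For `z` strictly above the noise singular values, the D-transform
`D(z) = φ(z)(cφ(z) + (1−c)/z)` with `φ(z) = (1/(q−r)) Σᵢ z/(z²−tᵢ²)` satisfies
`D(z) > 0`, `D′(z) < 0`, and the OptShrink shrinkage value `−2D(z)/D′(z)` is positive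
and no larger than `z`. -/
theorem optshrink_shrinkage_bounds
    (q r : ℕ) (hrq : r < q)
    (t : Fin (q - r) → ℝ) (ht : ∀ i, 0 ≤ t i)
    (c : ℝ) (hc0 : 0 < c) (hc1 : c ≤ 1)
    (z : ℝ) (hz0 : 0 < z) (hzt : ∀ i, t i < z)
    (φ D : ℝ → ℝ)
    (hφ : ∀ s, φ s = (1 / ((q : ℝ) - (r : ℝ))) * ∑ i, s / (s ^ 2 - t i ^ 2))
    (hD : ∀ s, D s = φ s * (c * φ s + (1 - c) / s)) :
    0 < D z ∧ deriv D z < 0 ∧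
    0 < -2 * D z / deriv D z ∧ -2 * D z / deriv D z ≤ z := by
  have hqr : (0 : ℝ) < (q : ℝ) - r := sub_pos.mpr (by exact_mod_cast hrq)
  have hgap : ∀ i, 0 < z ^ 2 - t i ^ 2 := fun i =>
    sub_pos.mpr (pow_lt_pow_left₀ (hzt i) (ht i) two_ne_zero)
  have : Nonempty (Fin (q - r)) := ⟨⟨0, Nat.sub_pos_of_lt hrq⟩⟩
  have hφpos : 0 < φ z := by
    rw [hφ]
    exact mul_pos (one_div_pos.mpr hqr)
      (Finset.sum_pos (fun i _ => div_pos hz0 (hgap i)) Finset.univ_nonempty)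
  obtain ⟨φ', hφ', hφ'le⟩ : ∃ φ', HasDerivAt φ φ' z ∧ φ' ≤ -φ z / z := by
    refine ⟨(1 / ((q : ℝ) - r)) * ∑ i, -(z ^ 2 + t i ^ 2) / (z ^ 2 - t i ^ 2) ^ 2, ?_, ?_⟩
    · rw [funext hφ]
      exact (HasDerivAt.fun_sum fun i _ =>
        hasDerivAt_div_sq_sub_sq (hgap i).ne').const_mul _
    · rw [hφ, ← mul_neg, mul_div_assoc, ← Finset.sum_neg_distrib, Finset.sum_div]
      exact mul_le_mul_of_nonneg_left
        (Finset.sum_le_sum fun i _ => neg_sq_add_sq_div_le hz0 (hgap i))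
        (one_div_pos.mpr hqr).le
  have hc : 0 ≤ 1 - c := sub_nonneg.mpr hc1
  have hfactor : 0 < c * φ z + (1 - c) / z :=
    add_pos_of_pos_of_nonneg (mul_pos hc0 hφpos) (div_nonneg hc hz0.le)
  have hDpos : 0 < D z := by
    rw [hD]
    exact mul_pos hφpos hfactor
  have hD' : HasDerivAt D
      (φ' * (c * φ z + (1 - c) / z) + φ z * (c * φ' + -(1 - c) / z ^ 2)) z := by
    rw [funext hD]
    have hinv : HasDerivAt (fun s : ℝ => (1 - c) / s) (-(1 - c) / z ^ 2) z := by
      simpa using (hasDerivAt_const z (1 - c)).fun_div (hasDerivAt_id z) hz0.ne'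
    exact hφ'.fun_mul ((hφ'.const_mul c).fun_add hinv)
  have hD'le : deriv D z ≤ -2 * D z / z := by
    rw [hD'.deriv, hD]
    calc φ' * (c * φ z + (1 - c) / z) + φ z * (c * φ' + -(1 - c) / z ^ 2)
        ≤ -φ z / z * (c * φ z + (1 - c) / z)
          + φ z * (c * (-φ z / z) + -(1 - c) / z ^ 2) := by gcongr
      _ = -2 * (φ z * (c * φ z + (1 - c) / z)) / z := by
        field_simp
        ring
  have hD'neg : deriv D z < 0 :=
    hD'le.trans_lt (div_neg_of_neg_of_pos (by linarith) hz0)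
  refine ⟨hDpos, hD'neg, div_pos_of_neg_of_neg (by linarith) hD'neg, ?_⟩
  rw [div_le_iff_of_neg hD'neg, mul_comm]
  exact (le_div_iff₀ hz0).mp hD'le
end
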